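/- For each n ∈ ℕ let U_n be uniformly distributed on the set B_n of binary trees with n nodes. Then the random function (t(U_n, u))_{u∈V} converges in distribution, in the product topology on [0,1]^V, to the random function (1_{u ≺ V})_{u∈V}, where V is uniformly (Haar) distributed on V_∞ = {0,1}^ℕ and 1_{u ≺ V} equals 1 if u is a prefix of V and 0 otherwise. Equivalently, uniform binary trees converge in distribution in the subtree size topology to the random Dirac measure δ_V with V uniform on V_∞. -/

import Mathlib

open MeasureTheory ProbabilityTheory Filter Topology
open scoped ENNReal NNReal

namespace DMTCS

/-- `V = {0,1}^*`: the set of finite binary words. -/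
abbrev Word : Type := List Bool

/-- `V_∞ = {0,1}^ℕ`: infinite binary sequences, with the product (Borel) σ-field. -/
abbrev BSeq : Type := ℕ → Bool

/-- The prefix of length `k` of an infinite sequence. -/
def prefixSeq (v : BSeq) (k : ℕ) : Word := List.ofFn (fun i : Fin k => v i)

/-- The cylinder set `B_u = {v ∈ V_∞ : u is a prefix of v}`. -/
def cyl (u : Word) : Set BSeq := {v | prefixSeq v u.length = u}

/-- A (finite) binary tree: a prefix-stable finite set of words. -/
def IsBinTree (x : Finset Word) : Prop := ∀ v ∈ x, v ≠ [] → v.dropLast ∈ x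

/-- The number of nodes of the subtree of `x` rooted at `u`, i.e. `|{v : u+v ∈ x}|`. -/
def subCard (x : Finset Word) (u : Word) : ℕ := (x.filter (fun w => u <+: w)).card

/-- The relative subtree size function `t(x,u)`. -/
noncomputable def stf (x : Finset Word) (u : Word) : ℝ := (subCard x u : ℝ) / (x.card : ℝ)

/-- The complete binary tree of height `n`: all words of length at most `n`. -/
def completeTree (n : ℕ) : Finset Word :=
  (Finset.range (n + 1)).biUnion
    (fun k => (Finset.univ : Finset (Fin k → Bool)).image (fun f => List.ofFn f))

instance : MeasurableSpace (Finset Word) := ⊤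

instance (x : Finset Word) : Decidable (IsBinTree x) :=
  inferInstanceAs (Decidable (∀ v ∈ x, v ≠ [] → v.dropLast ∈ x))

/-- The set `𝔹_n` of binary trees with exactly `n` nodes (every such tree consists of
words of length `< n`, hence is contained in the complete tree of height `n`). -/
def binTreesN (n : ℕ) : Finset (Finset Word) :=
  (completeTree n).powerset.filter (fun y => IsBinTree y ∧ y.card = n)

/-- The uniform distribution on a finite set. -/
noncomputable def uniformFinset {α : Type*} [MeasurableSpace α] (s : Finset α) : Measure α :=
  (s.card : ℝ≥0∞)⁻¹ • ∑ a ∈ s, Measure.dirac a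

theorem aux_append {x : Finset Word} (hx : IsBinTree x) (w u : Word) (h : w ++ u ∈ x) : w ∈ x := by
  induction u using List.reverseRecOn with
  | nil => simpa using h
  | append_singleton u b ih =>
    apply ih
    have := hx _ h (by simp)
    rwa [← List.append_assoc, List.dropLast_concat] at this

theorem aux_prefix {x : Finset Word} (hx : IsBinTree x) {w u : Word} (h : w <+: u) (hu : u ∈ x) :
    w ∈ x := by
  obtain ⟨t, rfl⟩ := h
  exact aux_append hx _ _ hu

theorem aux_length {x : Finset Word} (hx : IsBinTree x) {u : Word} (hu : u ∈ x) :
    u.length < x.card := by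
  have h1 : (Finset.range (u.length + 1)).card ≤ x.card := by
    apply Finset.card_le_card_of_injOn (fun i => u.take i)
    · intro i _
      exact aux_prefix hx (List.take_prefix _ _) hu
    · intro i hi j hj hij
      have := congrArg List.length hij
      simp at this hi hj
      omega
  simpa using h1

theorem mem_binTreesN {n : ℕ} {x : Finset Word} :
    x ∈ binTreesN n ↔ IsBinTree x ∧ x.card = n := by
  unfold binTreesN
  simp only [Finset.mem_filter, Finset.mem_powerset, and_iff_right_iff_imp]
  rintro ⟨hx, hc⟩ u hu
  simp only [completeTree, Finset.mem_biUnion, Finset.mem_range, Finset.mem_image,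
    Finset.mem_univ, true_and]
  have := aux_length hx hu
  exact ⟨u.length, by omega, u.get, List.ofFn_get u⟩

/-- join of two trees below a new root -/
def jn (a b : Finset Word) : Finset Word :=
  insert [] (a.image (List.cons false) ∪ b.image (List.cons true))

/-- subtree at a child of the root -/
noncomputable def sb (x : Finset Word) (c : Bool) : Finset Word :=
  x.preimage (List.cons c) (List.cons_injective.injOn)

theorem mem_sb {x : Finset Word} {c : Bool} {w : Word} : w ∈ sb x c ↔ c :: w ∈ x := by
  simp [sb]

theorem nil_mem_jn (a b : Finset Word) : [] ∈ jn a b := by simp [jn]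

theorem cons_mem_jn {a b : Finset Word} {c : Bool} {w : Word} :
    c :: w ∈ jn a b ↔ w ∈ (if c then b else a) := by
  cases c <;> simp [jn]

theorem sb_jn (a b : Finset Word) (c : Bool) : sb (jn a b) c = if c then b else a := by
  ext w; rw [mem_sb, cons_mem_jn]

theorem card_jn (a b : Finset Word) : (jn a b).card = a.card + b.card + 1 := by
  unfold jn
  rw [Finset.card_insert_of_notMem (by simp), Finset.card_union_of_disjoint,
    Finset.card_image_of_injective _ List.cons_injective,
    Finset.card_image_of_injective _ List.cons_injective]
  rw [Finset.disjoint_left]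
  intro w h1 h2
  simp only [Finset.mem_image] at h1 h2
  obtain ⟨p, _, rfl⟩ := h1
  obtain ⟨q, _, h⟩ := h2
  simp at h

theorem jn_sb {x : Finset Word} (h : [] ∈ x) : jn (sb x false) (sb x true) = x := by
  ext w
  cases w with
  | nil => simp [nil_mem_jn, h]
  | cons c w => rw [cons_mem_jn]; cases c <;> simp [mem_sb]

theorem tree_sb {x : Finset Word} (hx : IsBinTree x) (c : Bool) : IsBinTree (sb x c) := by
  intro v hv hne
  rw [mem_sb] at hv ⊢
  have := hx _ hv (by simp)
  rwa [List.dropLast_cons_of_ne_nil hne] at this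

theorem tree_jn {a b : Finset Word} (ha : IsBinTree a) (hb : IsBinTree b) :
    IsBinTree (jn a b) := by
  intro v hv hne
  cases v with
  | nil => simp at hne
  | cons c w =>
    by_cases hw : w = []
    · subst hw; simp [nil_mem_jn]
    · rw [List.dropLast_cons_of_ne_nil hw]
      rw [cons_mem_jn] at hv ⊢
      cases c
      · simpa using ha _ (by simpa using hv) hw
      · simpa using hb _ (by simpa using hv) hw

theorem nil_mem {x : Finset Word} (hx : IsBinTree x) (h : 0 < x.card) : [] ∈ x := by
  obtain ⟨u, hu⟩ := Finset.card_pos.1 h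
  exact aux_prefix hx (List.nil_prefix) hu

theorem card_succ (n : ℕ) : (binTreesN (n+1)).card =
    ∑ ij ∈ Finset.HasAntidiagonal.antidiagonal n, (binTreesN ij.1).card * (binTreesN ij.2).card := by
  have : ∀ ij ∈ Finset.HasAntidiagonal.antidiagonal n, (binTreesN ij.1).card * (binTreesN ij.2).card =
    (binTreesN ij.1 ×ˢ binTreesN ij.2).card := fun ij _ => (Finset.card_product _ _).symm
  rw [Finset.sum_congr rfl this, ← Finset.card_sigma]
  apply Finset.card_nbij' (fun x => ⟨((sb x false).card, (sb x true).card), (sb x false, sb x true)⟩)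
    (fun p => jn p.2.1 p.2.2)
  · intro x hx
    have hx := mem_binTreesN.1 hx
    have h0 := nil_mem hx.1 (by omega)
    have h1 := card_jn (sb x false) (sb x true)
    rw [jn_sb h0] at h1
    simp only [Finset.coe_sigma, Set.mem_sigma_iff, Finset.mem_coe, Finset.HasAntidiagonal.mem_antidiagonal,
      Finset.mem_product, mem_binTreesN, tree_sb hx.1, and_self, and_true]
    omega
  · rintro ⟨⟨i, j⟩, a, b⟩ h
    simp only [Finset.coe_sigma, Set.mem_sigma_iff, Finset.mem_coe, Finset.HasAntidiagonal.mem_antidiagonal,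
      Finset.mem_product, mem_binTreesN] at h ⊢
    refine ⟨tree_jn h.2.1.1 h.2.2.1, ?_⟩
    rw [card_jn]; omega
  · intro x hx
    have hx := mem_binTreesN.1 hx
    exact jn_sb (nil_mem hx.1 (by omega))
  · rintro ⟨⟨i, j⟩, a, b⟩ h
    simp only [Finset.coe_sigma, Set.mem_sigma_iff, Finset.mem_coe, Finset.HasAntidiagonal.mem_antidiagonal,
      Finset.mem_product, mem_binTreesN] at h ⊢
    obtain ⟨h1, ⟨h2, rfl⟩, h3, rfl⟩ := h
    simp [sb_jn]

theorem card_binTreesN (n : ℕ) : (binTreesN n).card = catalan n := by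
  induction n using Nat.strong_induction_on with
  | _ n ih =>
    cases n with
    | zero =>
      rw [catalan_zero, Finset.card_eq_one]
      refine ⟨∅, ?_⟩
      ext x
      rw [mem_binTreesN, Finset.mem_singleton, Finset.card_eq_zero]
      constructor
      · exact fun h => h.2
      · rintro rfl; exact ⟨fun v hv => by simp at hv, rfl⟩
    | succ n =>
      rw [card_succ, catalan_succ']
      apply Finset.sum_congr rfl
      intro ij h
      have := Finset.HasAntidiagonal.mem_antidiagonal.1 h
      rw [ih _ (by omega), ih _ (by omega)]

/-- trees with at most M nodes not below u -/
def good (n : ℕ) (u : Word) (M : ℕ) : Finset (Finset Word) :=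
  (binTreesN n).filter (fun x => n ≤ subCard x u + M)

/-- join with prescribed side -/
def jb (c : Bool) (a b : Finset Word) : Finset Word := if c then jn a b else jn b a

theorem sb_jb (c : Bool) (a b : Finset Word) : sb (jb c a b) c = b ∧ sb (jb c a b) (!c) = a := by
  cases c <;> simp [jb, sb_jn]

theorem card_jb (c : Bool) (a b : Finset Word) : (jb c a b).card = a.card + b.card + 1 := by
  cases c <;> simp [jb, card_jn, add_comm]

theorem tree_jb (c : Bool) {a b : Finset Word} (ha : IsBinTree a) (hb : IsBinTree b) :
    IsBinTree (jb c a b) := by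
  cases c <;> simp [jb, tree_jn, *]

theorem subCard_cons (x : Finset Word) (c : Bool) (u : Word) :
    subCard (sb x c) u ≤ subCard x (c :: u) := by
  unfold subCard
  apply Finset.card_le_card_of_injOn (List.cons c)
  · intro w hw
    simp only [Finset.coe_filter, Set.mem_ofPred_eq, mem_sb] at hw ⊢
    simpa using hw
  · exact List.cons_injective.injOn

theorem good_cons (n : ℕ) (c : Bool) (u : Word) (M J : ℕ) (hJ : J ≤ n) :
    ∑ j ∈ Finset.range J, catalan j * (good (n-j) u M).card ≤ (good (n+1) (c :: u) (M+J+1)).card := by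
  have : ∀ j ∈ Finset.range J, catalan j * (good (n-j) u M).card =
    (binTreesN j ×ˢ good (n-j) u M).card := fun j _ => by
      rw [Finset.card_product, card_binTreesN]
  rw [Finset.sum_congr rfl this, ← Finset.card_sigma]
  apply Finset.card_le_card_of_injOn (fun p => jb c p.2.1 p.2.2)
  · rintro ⟨j, a, b⟩ h
    simp only [Finset.coe_sigma, Set.mem_sigma_iff, Finset.mem_coe, Finset.mem_range,
      Finset.mem_product, mem_binTreesN, good, Finset.mem_filter] at h ⊢
    refine ⟨⟨tree_jb c h.2.1.1 h.2.2.1.1, ?_⟩, ?_⟩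
    · rw [card_jb]; omega
    · have := subCard_cons (jb c a b) c u
      rw [(sb_jb c a b).1] at this
      omega
  · rintro ⟨j, a, b⟩ h ⟨j', a', b'⟩ h' he
    simp only [Finset.coe_sigma, Set.mem_sigma_iff, Finset.mem_coe, Finset.mem_range,
      Finset.mem_product, mem_binTreesN, good, Finset.mem_filter] at h h' he
    have e1 : a = a' := by rw [← (sb_jb c a b).2, he, (sb_jb c a' b').2]
    have e2 : b = b' := by rw [← (sb_jb c a b).1, he, (sb_jb c a' b').1]
    have e3 : j = j' := by rw [← h.2.1.2, ← h'.2.1.2, e1]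
    subst e1 e2 e3
    rfl

theorem catalan_pos' (n : ℕ) : 0 < catalan n := by
  have := succ_mul_catalan_eq_centralBinom n
  have h2 := Nat.centralBinom_pos n
  rw [← this] at h2
  exact Nat.pos_of_mul_pos_left h2

theorem catalan_rec (n : ℕ) : ((n:ℝ)+2) * catalan (n+1) = 2*(2*n+1) * catalan n := by
  have h1 := succ_mul_catalan_eq_centralBinom n
  have h2 := succ_mul_catalan_eq_centralBinom (n+1)
  have h3 := Nat.succ_mul_centralBinom_succ n
  rw [← h1, ← h2] at h3
  have h4 : ((n:ℝ)+1) * ((n+1+1) * catalan (n+1)) = 2*(2*n+1)*((n+1)*catalan n) := by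
    exact_mod_cast h3
  have : (n:ℝ)+1 ≠ 0 := by positivity
  apply mul_left_cancel₀ this
  linarith

theorem ratio1 : Tendsto (fun n : ℕ => (catalan n : ℝ) / catalan (n+1)) atTop (𝓝 (1/4)) := by
  have h : ∀ n : ℕ, (catalan n : ℝ) / catalan (n+1) = 1/4 + (3/8) * (1/((n:ℝ)+1/2)) := by
    intro n
    have h1 : (0:ℝ) < catalan n := by exact_mod_cast catalan_pos' n
    have h2 : (0:ℝ) < catalan (n+1) := by exact_mod_cast catalan_pos' _
    have h3 := catalan_rec n
    have h4 : (n:ℝ) + 1/2 ≠ 0 := by positivity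
    field_simp
    nlinarith
  simp_rw [h]
  have : Tendsto (fun n : ℕ => 1/4 + (3/8:ℝ) * (1/((n:ℝ)+1/2))) atTop (𝓝 (1/4 + 3/8*0)) := by
    apply Tendsto.const_add
    apply Tendsto.const_mul
    simp_rw [one_div]
    apply Tendsto.inv_tendsto_atTop
    exact tendsto_atTop_add_const_right _ _ tendsto_natCast_atTop_atTop
  simpa using this

theorem ratio (j : ℕ) : Tendsto (fun n : ℕ => (catalan n : ℝ) / catalan (n+j)) atTop (𝓝 ((1/4)^j)) := by
  induction j with
  | zero =>
    have : ∀ n : ℕ, (catalan n : ℝ) / catalan (n+0) = 1 := fun n => by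
      have h1 : (catalan n : ℝ) ≠ 0 := by exact_mod_cast (catalan_pos' n).ne'
      simp [h1]
    simp_rw [this]; simp
  | succ j ih =>
    have := ih.mul (ratio1.comp (tendsto_add_atTop_nat j))
    rw [← pow_succ] at this
    refine this.congr fun n => ?_
    have h1 : (catalan (n+j) : ℝ) ≠ 0 := by exact_mod_cast (catalan_pos' _).ne'
    simp only [Function.comp]
    rw [div_mul_div_cancel₀ h1]
    rfl

theorem ratio' (j : ℕ) : Tendsto (fun n : ℕ => (catalan (n-j) : ℝ) / catalan (n+1)) atTop
    (𝓝 ((1/4)^(j+1))) := by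
  have := (ratio (j+1)).comp (tendsto_sub_atTop_nat j)
  refine this.congr' ?_
  filter_upwards [eventually_ge_atTop j] with n hn
  simp only [Function.comp]
  congr 3
  omega

/-- normalized central binomial -/
noncomputable def bb (n : ℕ) : ℝ := Nat.centralBinom n / 4^n

theorem bb_succ (n : ℕ) : bb (n+1) = bb n * ((2*n+1)/(2*n+2)) := by
  have h3 : ((n:ℝ)+1) * Nat.centralBinom (n+1) = 2*(2*n+1)*Nat.centralBinom n := by
    exact_mod_cast Nat.succ_mul_centralBinom_succ n
  unfold bb
  have : (n:ℝ)+1 ≠ 0 := by positivity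
  rw [pow_succ]
  field_simp
  linarith

theorem sum_cat (J : ℕ) : ∑ j ∈ Finset.range J, (catalan j : ℝ) * (1/4)^(j+1) = 1/2 * (1 - bb J) := by
  induction J with
  | zero => simp [bb]
  | succ J ih =>
    rw [Finset.sum_range_succ, ih, bb_succ]
    have h1 : ((J:ℝ)+1) * catalan J = Nat.centralBinom J := by
      exact_mod_cast succ_mul_catalan_eq_centralBinom J
    have : (J:ℝ)+1 ≠ 0 := by positivity
    unfold bb
    rw [← h1, one_div_pow, pow_succ]
    field_simp
    ring

theorem bb_pos (n : ℕ) : 0 < bb n := by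
  have : (0:ℝ) < Nat.centralBinom n := by exact_mod_cast Nat.centralBinom_pos n
  unfold bb; positivity

theorem bb_sq (n : ℕ) : bb n ^ 2 * (2*n+1) ≤ 1 := by
  induction n with
  | zero => simp [bb]
  | succ n ih =>
    refine le_trans ?_ ih
    rw [bb_succ, mul_pow, mul_assoc]
    apply mul_le_mul_of_nonneg_left _ (by positivity)
    push_cast
    rw [div_pow, div_mul_eq_mul_div, div_le_iff₀ (by positivity)]
    have : (0:ℝ) ≤ n := by positivity
    nlinarith

theorem bb_lt (ε : ℝ) (hε : 0 < ε) : ∃ J, bb J < ε := by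
  obtain ⟨n, hn⟩ := exists_nat_gt (1/ε^2)
  refine ⟨n, ?_⟩
  by_contra! h
  have h1 := bb_sq n
  rw [div_lt_iff₀ (by positivity)] at hn
  have h2 : ε^2 ≤ bb n ^ 2 := by gcongr
  have : (0:ℝ) ≤ n := by positivity
  nlinarith [sq_nonneg (bb n), mul_le_mul_of_nonneg_left h2 this]

/-- probability of good -/
noncomputable def pp (n : ℕ) (u : Word) (M : ℕ) : ℝ := (good n u M).card / catalan n

theorem pp_mono (n : ℕ) (u : Word) {M M' : ℕ} (h : M ≤ M') : pp n u M ≤ pp n u M' := by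
  unfold pp
  gcongr
  intro x hx
  simp only [good, Finset.mem_filter] at hx ⊢
  exact ⟨hx.1, by omega⟩

theorem pp_lower (u : Word) : ∀ ε > 0, ∃ M, ∀ᶠ n in atTop, (1/2:ℝ)^u.length - ε ≤ pp n u M := by
  induction u with
  | nil =>
    intro ε hε
    refine ⟨0, Eventually.of_forall fun n => ?_⟩
    have h : good n [] 0 = binTreesN n := by
      apply Finset.filter_true_of_mem
      intro x hx
      simp [subCard, (mem_binTreesN.1 hx).2]
    have h1 : (catalan n : ℝ) ≠ 0 := by exact_mod_cast (catalan_pos' n).ne'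
    rw [pp, h, card_binTreesN, div_self h1]
    simp [hε.le]
  | cons c u ih =>
    intro ε hε
    obtain ⟨M, hM⟩ := ih (ε/4) (by positivity)
    obtain ⟨J, hJ⟩ := bb_lt (ε/4) (by positivity)
    refine ⟨M+J+1, ?_⟩
    set q : ℝ := (1/2:ℝ)^u.length with hq
    have hq0 : 0 ≤ q := by positivity
    have hq1 : q ≤ 1 := pow_le_one₀ (by norm_num) (by norm_num)
    have hlim : Tendsto (fun n : ℕ => ∑ j ∈ Finset.range J,
        (catalan j : ℝ) * ((catalan (n-j) : ℝ) / catalan (n+1)) * (q - ε/4)) atTop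
        (𝓝 (∑ j ∈ Finset.range J, (catalan j : ℝ) * (1/4)^(j+1) * (q - ε/4))) :=
      tendsto_finsetSum _ fun j _ => ((ratio' j).const_mul _).mul_const _
    rw [← Finset.sum_mul, sum_cat] at hlim
    have hlt : q * (1/2) - ε < 1/2 * (1 - bb J) * (q - ε/4) := by
      nlinarith [bb_pos J]
    have hev := hlim.eventually (lt_mem_nhds hlt)
    have hM' : ∀ᶠ n : ℕ in atTop, ∀ j ∈ Finset.range J, q - ε/4 ≤ pp (n-j) u M := by
      rw [Filter.eventually_all_finset]
      intro j _
      exact (tendsto_sub_atTop_nat j).eventually hM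
    rw [← Filter.map_add_atTop_eq_nat 1, eventually_map]
    filter_upwards [hev, hM', eventually_ge_atTop J] with n h1 h2 h3
    rw [List.length_cons, pow_succ]
    refine h1.le.trans ?_
    have h4 : (∑ j ∈ Finset.range J, (catalan j : ℝ) * (good (n-j) u M).card) ≤
      (good (n+1) (c :: u) (M+J+1)).card := by exact_mod_cast good_cons n c u M J h3
    have h5 : (0:ℝ) < catalan (n+1) := by exact_mod_cast catalan_pos' _
    calc _ ≤ ∑ j ∈ Finset.range J,
        (catalan j : ℝ) * ((catalan (n-j) : ℝ) / catalan (n+1)) * pp (n-j) u M := by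
          gcongr with j hj
          exact h2 j hj
      _ = (∑ j ∈ Finset.range J, (catalan j : ℝ) * (good (n-j) u M).card) / catalan (n+1) := by
          rw [Finset.sum_div]
          apply Finset.sum_congr rfl
          intro j _
          have h6 : (catalan (n-j) : ℝ) ≠ 0 := by exact_mod_cast (catalan_pos' _).ne'
          unfold pp
          field_simp
      _ ≤ _ := by
          unfold pp
          gcongr

theorem pp_lower_unif (k : ℕ) (ε : ℝ) (hε : 0 < ε) : ∃ M, ∀ᶠ n in atTop, ∀ w : Fin k → Bool,
    (1/2:ℝ)^k - ε ≤ pp n (List.ofFn w) M := by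
  choose M hM using fun w : Fin k → Bool => pp_lower (List.ofFn w) ε hε
  refine ⟨∑ w, M w, ?_⟩
  rw [Filter.eventually_all]
  intro w
  filter_upwards [hM w] with n hn
  rw [List.length_ofFn] at hn
  exact hn.trans (pp_mono _ _ (Finset.single_le_sum (f := M) (fun _ _ => Nat.zero_le _) (Finset.mem_univ w)))

theorem subCard_add {x : Finset Word} {s u : Word} (h : ∀ w : Word, s <+: w → u <+: w → False) :
    subCard x s + subCard x u ≤ x.card := by
  unfold subCard
  rw [← Finset.card_union_of_disjoint]
  · exact Finset.card_le_card (Finset.union_subset (Finset.filter_subset _ _) (Finset.filter_subset _ _))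
  · rw [Finset.disjoint_left]
    intro w h1 h2
    exact h w (Finset.mem_filter.1 h1).2 (Finset.mem_filter.1 h2).2

theorem subCard_le (x : Finset Word) (s : Word) : subCard x s ≤ x.card :=
  Finset.card_filter_le _ _

theorem subCard_mono (x : Finset Word) {s u : Word} (h : s <+: u) : subCard x u ≤ subCard x s := by
  unfold subCard
  apply Finset.card_le_card
  intro w hw
  rw [Finset.mem_filter] at hw ⊢
  exact ⟨hw.1, h.trans hw.2⟩

theorem good_disj {n k M : ℕ} (hM : 2 * M < n) {w w' : Fin k → Bool} (hw : w ≠ w') {x : Finset Word}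
    (h : x ∈ good n (List.ofFn w) M) (h' : x ∈ good n (List.ofFn w') M) : False := by
  simp only [good, Finset.mem_filter, mem_binTreesN] at h h'
  have := @subCard_add x (List.ofFn w) (List.ofFn w') (by
    intro z h1 h2
    apply hw
    have h3 := List.prefix_of_prefix_length_le h1 h2 (by simp)
    have h4 := h3.eq_of_length (by simp)
    exact List.ofFn_injective h4)
  omega

/-- limit function truncated -/
noncomputable def ee (u : Word) : Word → ℝ := fun s => if s <+: u then 1 else 0

/-- limit function -/
noncomputable def gg (v : BSeq) : Word → ℝ := fun u => if prefixSeq v u.length = u then (1 : ℝ) else 0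

theorem stf_close {n M : ℕ} {u : Word} {x : Finset Word} (hn : 0 < n) (h : x ∈ good n u M)
    (s : Word) (hs : s.length ≤ u.length) : |stf x s - ee u s| ≤ M / n := by
  simp only [good, Finset.mem_filter, mem_binTreesN] at h
  have hn' : (0:ℝ) < n := by exact_mod_cast hn
  have h0 : (n:ℝ) ≤ subCard x u + M := by exact_mod_cast h.2
  unfold stf ee
  rw [h.1.2]
  split_ifs with hp
  · have h1 : (subCard x u : ℝ) ≤ subCard x s := by exact_mod_cast subCard_mono x hp
    have h2 : (subCard x s : ℝ) ≤ n := by exact_mod_cast h.1.2 ▸ subCard_le x s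
    rw [div_sub_one hn'.ne', abs_div, abs_of_pos hn']
    gcongr
    rw [abs_le]; constructor <;> linarith
  · have h1 := @subCard_add x s u (fun w h1 h2 => hp (List.prefix_of_prefix_length_le h1 h2 hs))
    rw [h.1.2] at h1
    have h2 : (subCard x s : ℝ) + subCard x u ≤ n := by exact_mod_cast h1
    rw [sub_zero, abs_of_nonneg (by positivity)]
    gcongr
    linarith

theorem prefixSeq_prefix (v : BSeq) {i k : ℕ} (h : i ≤ k) : prefixSeq v i <+: prefixSeq v k := by
  have : prefixSeq v i = (prefixSeq v k).take i := by
    apply List.ext_getElem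
    · simp [prefixSeq, h]
    · intro m h1 h2
      simp [prefixSeq]
  rw [this]; exact List.take_prefix _ _

theorem gg_eq (v : BSeq) (k : ℕ) (s : Word) (hs : s.length ≤ k) :
    gg v s = ee (prefixSeq v k) s := by
  unfold gg ee
  congr 1
  apply propext
  constructor
  · intro h
    have := prefixSeq_prefix v hs
    rwa [h] at this
  · intro h
    have := List.prefix_of_prefix_length_le h (prefixSeq_prefix v hs) (by simp [prefixSeq])
    exact (this.eq_of_length (by simp [prefixSeq])).symm

/-- the cube -/
def cube : Set (Word → ℝ) := Set.pi Set.univ (fun _ => Set.Icc 0 1)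

theorem stf_cube (x : Finset Word) : (fun u => stf x u) ∈ cube := by
  intro u _
  refine ⟨by unfold stf; positivity, ?_⟩
  unfold stf
  apply div_le_one_of_le₀ _ (by positivity)
  exact_mod_cast subCard_le x u

theorem ee_cube (u : Word) : ee u ∈ cube := by
  intro s _
  simp only [ee]; split_ifs <;> simp

theorem gg_cube (u : BSeq) : gg u ∈ cube := by
  intro s _
  simp only [gg]; split_ifs <;> simp

theorem unif (f : BoundedContinuousFunction (Word → ℝ) ℝ) (ε : ℝ) (hε : 0 < ε) :
    ∃ k : ℕ, ∃ δ > 0, ∀ x ∈ cube, ∀ y ∈ cube, (∀ s : Word, s.length ≤ k → |x s - y s| < δ) →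
      |f x - f y| < ε := by
  have hK : IsCompact cube := isCompact_univ_pi fun _ => isCompact_Icc
  have hu := hK.uniformContinuousOn_of_continuous f.continuous.continuousOn
  have h1 := hu (Metric.dist_mem_uniformity hε)
  rw [Filter.mem_map, Filter.mem_inf_principal, Pi.uniformity] at h1
  obtain ⟨I, hI, V, hV, -, h2, -⟩ := Filter.mem_iInf'.1 h1
  have h3 : ∀ i, ∃ δ > 0, ∀ x y : Word → ℝ, |x i - y i| < δ → (x, y) ∈ V i := by
    intro i
    obtain ⟨t, ht, htV⟩ := Filter.mem_comap.1 (hV i)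
    obtain ⟨δ, hδ, h⟩ := Metric.mem_uniformity_dist.1 ht
    exact ⟨δ, hδ, fun x y hxy => htV (h (by simpa [Real.dist_eq] using hxy))⟩
  choose δ hδ hδV using h3
  obtain ⟨d, hd, hdI⟩ : ∃ d > 0, ∀ i ∈ I, d ≤ δ i := by
    clear h2
    induction I, hI using Set.Finite.induction_on with
    | empty => exact ⟨1, one_pos, by simp⟩
    | insert _ _ ih =>
      obtain ⟨d, hd, h⟩ := ih
      rename_i a s _ _
      refine ⟨min d (δ a), lt_min hd (hδ a), ?_⟩
      rintro i (rfl | hi)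
      · exact min_le_right _ _
      · exact (min_le_left _ _).trans (h i hi)
  obtain ⟨k, hk⟩ := (hI.image List.length).bddAbove
  refine ⟨k, d, hd, fun x hx y hy h => ?_⟩
  have h4 : (x, y) ∈ ⋂ i ∈ I, V i := by
    simp only [Set.mem_iInter]
    intro i hi
    exact hδV i x y ((h i (hk ⟨i, hi, rfl⟩)).trans_le (hdI i hi))
  rw [← h2] at h4
  exact h4 ⟨hx, hy⟩

theorem meas_cyl (u : Word) : MeasurableSet (cyl u) := by
  have : Measurable (fun v : BSeq => (fun i : Fin u.length => v i)) :=
    measurable_pi_lambda _ fun i => measurable_pi_apply _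
  exact this (t := {w | List.ofFn w = u}) (Set.toFinite _).measurableSet

theorem meas_gg : Measurable gg := by
  refine measurable_pi_lambda _ fun u => ?_
  exact Measurable.ite (meas_cyl u) measurable_const measurable_const

theorem sum_cyl {k : ℕ} (v : BSeq) (F : (Fin k → Bool) → ℝ) :
    ∑ w, (cyl (List.ofFn w)).indicator (fun _ => F w) v = F (fun i => v i) := by
  rw [Finset.sum_eq_single (fun i : Fin k => v i)]
  · apply Set.indicator_of_mem
    simp [cyl, prefixSeq]
  · intro w _ hw
    apply Set.indicator_of_notMem
    intro h
    apply hw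
    simp only [cyl, Set.mem_ofPred_eq, prefixSeq] at h
    rw [List.length_ofFn] at h
    exact (List.ofFn_injective h).symm
  · simp

theorem lim_close (ν : Measure BSeq) (hprob : IsProbabilityMeasure ν)
    (hHaar : ∀ u : Word, ν (cyl u) = (2 : ℝ≥0∞)⁻¹ ^ u.length)
    (f : BoundedContinuousFunction (Word → ℝ) ℝ) (ε : ℝ) (k : ℕ)
    (h : ∀ v : BSeq, |f (gg v) - f (ee (prefixSeq v k))| ≤ ε) :
    |∫ v, f (gg v) ∂ν - ∑ w : Fin k → Bool, (1/2:ℝ)^k * f (ee (List.ofFn w))| ≤ ε := by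
  have hintg : ∀ w : Fin k → Bool, Integrable
      ((cyl (List.ofFn w)).indicator (fun _ => f (ee (List.ofFn w)))) ν :=
    fun w => (integrable_const _).indicator (meas_cyl _)
  have h1 : ∑ w : Fin k → Bool, (1/2:ℝ)^k * f (ee (List.ofFn w)) =
      ∫ v, f (ee (prefixSeq v k)) ∂ν := by
    have : ∀ v : BSeq, f (ee (prefixSeq v k)) = ∑ w : Fin k → Bool,
        (cyl (List.ofFn w)).indicator (fun _ => f (ee (List.ofFn w))) v := fun v => by
      rw [sum_cyl v (fun w => f (ee (List.ofFn w)))]; rfl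
    simp_rw [this]
    rw [integral_finsetSum _ (fun w _ => hintg w)]
    apply Finset.sum_congr rfl
    intro w _
    rw [integral_indicator_const _ (meas_cyl _), measureReal_def, hHaar]
    simp
  have hi2 : Integrable (fun v => f (ee (prefixSeq v k))) ν := by
    have : (fun v : BSeq => f (ee (prefixSeq v k))) = fun v => ∑ w : Fin k → Bool,
        (cyl (List.ofFn w)).indicator (fun _ => f (ee (List.ofFn w))) v := by
      funext v
      rw [sum_cyl v (fun w => f (ee (List.ofFn w)))]; rfl
    rw [this]
    exact integrable_finsetSum _ (fun w _ => hintg w)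
  have hi1 : Integrable (fun v => f (gg v)) ν := by
    apply Integrable.of_bound (C := ‖f‖)
    · exact (f.continuous.measurable.comp meas_gg).aestronglyMeasurable
    · exact Eventually.of_forall fun v => f.norm_coe_le_norm _
  rw [h1, ← integral_sub hi1 hi2, ← Real.norm_eq_abs]
  refine (norm_integral_le_of_norm_le_const (C := ε) (Eventually.of_forall fun v => ?_)).trans ?_
  · exact h v
  · simp

theorem integral_unif (n : ℕ) (F : Finset Word → ℝ) :
    ∫ y, F y ∂(uniformFinset (binTreesN n)) = (∑ x ∈ binTreesN n, F x) / catalan n := by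
  unfold uniformFinset
  rw [integral_smul_measure, integral_finsetSum_measure]
  · simp [integral_dirac, card_binTreesN, div_eq_inv_mul]
  · intro x _
    exact integrable_dirac (by simp)

theorem main_close (f : BoundedContinuousFunction (Word → ℝ) ℝ) (ε δ η : ℝ) (k n M : ℕ)
    (hε : 0 ≤ ε)
    (hf : ∀ x ∈ cube, ∀ y ∈ cube, (∀ s : Word, s.length ≤ k → |x s - y s| < δ) → |f x - f y| < ε)
    (hp : ∀ w : Fin k → Bool, (1/2:ℝ)^k - η ≤ pp n (List.ofFn w) M) (hM : 2 * M < n)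
    (hMδ : (M:ℝ) / n < δ) :
    |(∑ x ∈ binTreesN n, f (fun u => stf x u)) / catalan n
      - ∑ w : Fin k → Bool, (1/2:ℝ)^k * f (ee (List.ofFn w))| ≤ ε + ‖f‖ * (3 * 2^k * η) := by
  classical
  have hc : (0:ℝ) < catalan n := by exact_mod_cast catalan_pos' n
  set I : (Fin k → Bool) → Finset Word → ℝ :=
    fun w x => if x ∈ good n (List.ofFn w) M then 1 else 0 with hI
  have hsumI : ∀ w, (∑ x ∈ binTreesN n, I w x) / catalan n = pp n (List.ofFn w) M := by
    intro w
    simp only [hI, pp]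
    rw [Finset.sum_ite_mem, Finset.inter_eq_right.2 (show good n (List.ofFn w) M ⊆ binTreesN n from Finset.filter_subset _ _)]
    simp
  have hpt : ∀ x ∈ binTreesN n, ∑ w, I w x ≤ 1 ∧
      |f (fun u => stf x u) - ∑ w, I w x * f (ee (List.ofFn w))| ≤ ε + ‖f‖ * (1 - ∑ w, I w x) := by
    intro x hx
    by_cases h : ∃ w : Fin k → Bool, x ∈ good n (List.ofFn w) M
    · obtain ⟨w, hw⟩ := h
      have h0 : ∀ w', w' ≠ w → I w' x = 0 := by
        intro w' hne
        simp only [hI]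
        rw [if_neg]
        intro h'
        exact good_disj hM hne h' hw
      have h1 : I w x = 1 := by simp [hI, hw]
      rw [Finset.sum_eq_single w (fun w' _ h => h0 w' h) (by simp),
        Finset.sum_eq_single w (fun w' _ h => by rw [h0 w' h, zero_mul]) (by simp), h1]
      refine ⟨le_rfl, ?_⟩
      rw [one_mul, sub_self, mul_zero, add_zero]
      refine (hf _ (stf_cube x) _ (ee_cube _) fun s hs => ?_).le
      exact (stf_close (by omega) hw s (by simpa using hs)).trans_lt hMδ
    · push Not at h
      have h0 : ∀ w, I w x = 0 := fun w => by simp [hI, h w]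
      simp only [h0]
      have := f.norm_coe_le_norm (fun u => stf x u)
      rw [Real.norm_eq_abs] at this
      simp
      linarith
  have hcard : ∑ x ∈ binTreesN n, (1:ℝ) = catalan n := by simp [card_binTreesN]
  set p : (Fin k → Bool) → ℝ := fun w => pp n (List.ofFn w) M with hpdef
  have hS : (∑ x ∈ binTreesN n, ∑ w, I w x) / catalan n = ∑ w, p w := by
    rw [Finset.sum_comm, Finset.sum_div]
    exact Finset.sum_congr rfl fun w _ => hsumI w
  have hS1 : ∑ w, p w ≤ 1 := by
    rw [← hS, div_le_one hc, ← hcard]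
    exact Finset.sum_le_sum fun x hx => (hpt x hx).1
  have hA : |(∑ x ∈ binTreesN n, f (fun u => stf x u)) / catalan n
      - ∑ w, p w * f (ee (List.ofFn w))| ≤ ε + ‖f‖ * (1 - ∑ w, p w) := by
    have e1 : ∑ w, p w * f (ee (List.ofFn w)) =
        (∑ x ∈ binTreesN n, ∑ w, I w x * f (ee (List.ofFn w))) / catalan n := by
      rw [Finset.sum_comm, Finset.sum_div]
      refine Finset.sum_congr rfl fun w _ => ?_
      rw [← Finset.sum_mul, mul_div_right_comm, hsumI]
    rw [e1, ← sub_div, ← Finset.sum_sub_distrib, abs_div, abs_of_pos hc, div_le_iff₀ hc]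
    refine (Finset.abs_sum_le_sum_abs _ _).trans ?_
    refine (Finset.sum_le_sum fun x hx => (hpt x hx).2).trans_eq ?_
    rw [Finset.sum_add_distrib, ← Finset.mul_sum, Finset.sum_sub_distrib, hcard, ← hS]
    simp only [Finset.sum_const, card_binTreesN, nsmul_eq_mul]
    field_simp
  have hcw : ∑ w : Fin k → Bool, (1/2:ℝ)^k = 1 := by
    simp
  have hce : ∑ w : Fin k → Bool, η = 2^k * η := by simp
  have hlow : 1 - ∑ w, p w ≤ 2^k * η := by
    have := Finset.sum_le_sum (s := Finset.univ) fun w _ => hp w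
    rw [Finset.sum_sub_distrib, hcw, hce] at this
    linarith
  have hB : |∑ w, p w * f (ee (List.ofFn w)) - ∑ w : Fin k → Bool, (1/2:ℝ)^k * f (ee (List.ofFn w))|
      ≤ ‖f‖ * (2 * (2^k * η)) := by
    have hη : 0 ≤ 2^k * η := by linarith
    have hη0 : 0 ≤ η := by
      by_contra! hh
      have : (0:ℝ) < 2^k := by positivity
      nlinarith
    rw [← Finset.sum_sub_distrib]
    refine (Finset.abs_sum_le_sum_abs _ _).trans ?_
    calc _ ≤ ∑ w : Fin k → Bool, ‖f‖ * (p w - (1/2)^k + 2 * η) := by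
          refine Finset.sum_le_sum fun w _ => ?_
          rw [← sub_mul, abs_mul, mul_comm]
          have h1 := f.norm_coe_le_norm (ee (List.ofFn w))
          rw [Real.norm_eq_abs] at h1
          have h2 := hp w
          apply mul_le_mul h1 _ (abs_nonneg _) (norm_nonneg _)
          rw [abs_le]
          constructor <;> simp only [hpdef] <;> linarith
      _ ≤ _ := by
          rw [← Finset.mul_sum, Finset.sum_add_distrib, Finset.sum_sub_distrib, hcw,
            ← Finset.mul_sum, hce]
          apply mul_le_mul_of_nonneg_left _ (norm_nonneg _)
          linarith
  have := abs_sub_le ((∑ x ∈ binTreesN n, f (fun u => stf x u)) / catalan n)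
    (∑ w, p w * f (ee (List.ofFn w))) (∑ w : Fin k → Bool, (1/2:ℝ)^k * f (ee (List.ofFn w)))
  have h3 := mul_le_mul_of_nonneg_left hlow (norm_nonneg f)
  linarith

/-- Uniform binary trees converge in distribution, in the subtree size topology (i.e. in
the product topology on `[0,1]^V` of the random functions `u ↦ t(U_n,u)`), to the random
Dirac measure `δ_V` with `V` uniform (Haar) on `V_∞`: the limit of the subtree size
functions is `u ↦ 1_{u ≺ V}`. Here the Haar measure `ν` is characterized by
`ν(B_u) = 2^{-|u|}`. -/
theorem stmt11 (ν : Measure BSeq) (hprob : IsProbabilityMeasure ν)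
    (hHaar : ∀ u : Word, ν (cyl u) = (2 : ℝ≥0∞)⁻¹ ^ u.length) :
    ∀ f : BoundedContinuousFunction (Word → ℝ) ℝ,
      Tendsto (fun n => ∫ y, f (fun u => stf y u) ∂(uniformFinset (binTreesN n)))
        atTop
        (𝓝 (∫ v, f (fun u => if prefixSeq v u.length = u then (1 : ℝ) else 0) ∂ν)) := by
  intro f
  rw [Metric.tendsto_nhds]
  intro ε hε
  obtain ⟨k, δ, hδ, hf⟩ := unif f (ε/4) (by positivity)
  set η : ℝ := ε / 4 / ((‖f‖ + 1) * (3 * 2^k)) with hη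
  have hη0 : 0 < η := by positivity
  obtain ⟨M, hM⟩ := pp_lower_unif k η hη0
  have hMn : Tendsto (fun n : ℕ => (M:ℝ) / n) atTop (𝓝 0) := tendsto_const_div_atTop_nhds_zero_nat _
  filter_upwards [hM, eventually_gt_atTop (2*M), hMn.eventually (gt_mem_nhds hδ)] with n h1 h2 h3
  have hA := main_close f (ε/4) δ η k n M (by positivity) hf h1 h2 h3
  have hB := lim_close ν hprob hHaar f (ε/4) k (fun v => (hf _ (gg_cube v) _ (ee_cube _) fun s hs => by
    rw [gg_eq v k s hs]; simpa using hδ).le)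
  rw [integral_unif n (fun y => f (fun u => stf y u)), Real.dist_eq]
  change |_ - ∫ v, f (gg v) ∂ν| < ε
  have hC : ‖f‖ * (3 * 2^k * η) ≤ ε/4 := by
    have : (‖f‖ + 1) * (3 * 2^k * η) = ε/4 := by
      rw [hη]; field_simp
    have h4 : 0 ≤ 3 * 2^k * η := by positivity
    nlinarith
  have := abs_sub_le ((∑ x ∈ binTreesN n, f (fun u => stf x u)) / catalan n)
    (∑ w : Fin k → Bool, (1/2:ℝ)^k * f (ee (List.ofFn w))) (∫ v, f (gg v) ∂ν)
  rw [abs_sub_comm] at hB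
  linarith

end DMTCS
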